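/- Fix an integer d ≥ 0 and real numbers 0 < p < P < 1. In the medial regime multiparameter random simplicial complex model on n vertices with all simplex probabilities p_σ ∈ [p, P], the probability that the random complex is d-connected tends to 1 as n → ∞ (uniformly over the choices of the probabilities p_σ ∈ [p, P]). -/

import Mathlib

open Finset
open scoped Classical

/-- An abstract simplicial complex on vertex type `V`: a downward-closed family of
nonempty finite subsets of `V`. -/
structure SComplex (V : Type*) where
  faces : Set (Finset V)
  not_empty_mem : ∅ ∉ faces
  down_closed : ∀ {s t : Finset V}, s ∈ faces → t ⊆ s → t.Nonempty → t ∈ faces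

namespace SComplex

variable {V W : Type*}

/-- The vertex set of a simplicial complex. -/
def vertexSet (K : SComplex V) : Set V := {v | {v} ∈ K.faces}

/-- The geometric realization of a simplicial complex, as the set of convex-combination
coordinate functions supported on a simplex. -/
def realization (K : SComplex V) : Set (V → ℝ) :=
  {x | ∃ σ ∈ K.faces, (∀ v, 0 ≤ x v) ∧ (∀ v, v ∉ σ → x v = 0) ∧ (∑ v ∈ σ, x v) = 1}

/-- The geometric realization as a topological space. -/
abbrev space (K : SComplex V) : Type _ := ↥(K.realization)

/-- `L` is a subcomplex of `K`. -/
def IsSubcomplex (L K : SComplex V) : Prop := L.faces ⊆ K.faces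

/-- A complex is `r`-conic (`r` an integer, possibly `-1`) if every subcomplex with at
most `r` vertices is contained in the closed star of some vertex. -/
def IsConic (K : SComplex V) (r : ℤ) : Prop :=
  ∀ L : SComplex V, L.IsSubcomplex K → L.vertexSet.Finite →
    (L.vertexSet.ncard : ℤ) ≤ r →
    ∃ v ∈ K.vertexSet, ∀ σ ∈ L.faces, insert v σ ∈ K.faces

/-- The link of a vertex `v` in `K`. -/
def vertexLink (K : SComplex V) (v : V) : Set (Finset V) :=
  {τ ∈ K.faces | v ∉ τ ∧ insert v τ ∈ K.faces}

/-- A nonempty complex is `r`-ample if for every set `U` of at most `r` vertices and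
every subcomplex `L` with vertices in `U`, some vertex `v` has a link whose simplices
contained in `U` are exactly those of `L`. -/
def IsAmple (K : SComplex V) (r : ℕ) : Prop :=
  K.faces.Nonempty ∧
  ∀ U : Finset V, ↑U ⊆ K.vertexSet → U.card ≤ r →
    ∀ L : SComplex V, L.IsSubcomplex K → L.vertexSet ⊆ ↑U →
      ∃ v ∈ K.vertexSet, {τ ∈ K.vertexLink v | ↑τ ⊆ (U : Set V)} = L.faces

end SComplex

/-- A topological space is `n`-connected if it is nonempty and every continuous map
from the `k`-sphere, `0 ≤ k ≤ n`, is null-homotopic. -/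
def NConnected (n : ℕ) (X : Type*) [TopologicalSpace X] : Prop :=
  Nonempty X ∧ ∀ k : ℕ, k ≤ n →
    ∀ f : C(Metric.sphere (0 : EuclideanSpace ℝ (Fin (k + 1))) 1, X),
      f.Nullhomotopic

/-- The geometric realization of a family `F` of finite sets of vertices. -/
def realizationOf {V : Type*} (F : Set (Finset V)) : Set (V → ℝ) :=
  {x | ∃ σ ∈ F, (∀ v, 0 ≤ x v) ∧ (∀ v, v ∉ σ → x v = 0) ∧ (∑ v ∈ σ, x v) = 1}

/-- A finite family of finite sets is (the set of faces of) a simplicial complex. -/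
def IsComplexFamily {V : Type*} (F : Finset (Finset V)) : Prop :=
  ∅ ∉ F ∧ ∀ s ∈ F, ∀ t ⊆ s, t.Nonempty → t ∈ F

/-- The external simplices of `F`: nonempty sets that are not faces of `F` but all of
whose proper nonempty subsets are faces of `F`.  These are exactly the simplices that
were offered to, and rejected by, the multiparameter random model. -/
noncomputable def externalFaces {V : Type*} [Fintype V] (F : Finset (Finset V)) :
    Finset (Finset V) :=
  Finset.univ.filter fun σ =>
    σ ∉ F ∧ σ.Nonempty ∧ ∀ τ ⊂ σ, τ.Nonempty → τ ∈ F

/-- The probability that the multiparameter random simplicial complex with simplex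
probabilities `pr` equals the complex with face set `F`. -/
noncomputable def complexProb {V : Type*} [Fintype V] (pr : Finset V → ℝ)
    (F : Finset (Finset V)) : ℝ :=
  (∏ σ ∈ F, pr σ) * ∏ σ ∈ externalFaces F, (1 - pr σ)

section Probability

variable {V : Type*} [Fintype V]

/-- The probability that independent trials, one for every nonempty `σ` and successful with
probability `pr σ`, succeed exactly on the family `A`. -/
noncomputable def trialWeight (pr : Finset V → ℝ) (A : Finset (Finset V)) : ℝ :=
  (∏ σ ∈ A, pr σ) * ∏ σ ∈ univ.erase ∅ \ A, (1 - pr σ)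

/-- The largest simplicial complex contained in the family `A`. -/
noncomputable def complexOf (A : Finset (Finset V)) : Finset (Finset V) :=
  univ.filter fun σ => σ.Nonempty ∧ ∀ τ ⊆ σ, τ.Nonempty → τ ∈ A

lemma mem_complexOf {A : Finset (Finset V)} {σ : Finset V} :
    σ ∈ complexOf A ↔ σ.Nonempty ∧ ∀ τ ⊆ σ, τ.Nonempty → τ ∈ A := by
  simp [complexOf]

lemma isComplexFamily_complexOf (A : Finset (Finset V)) : IsComplexFamily (complexOf A) := by
  refine ⟨fun h => ?_, fun s hs t ht htn => ?_⟩
  · simpa using (mem_complexOf.1 h).1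
  · exact mem_complexOf.2 ⟨htn, fun τ hτ => (mem_complexOf.1 hs).2 τ (hτ.trans ht)⟩

lemma complexOf_eq_iff {A F : Finset (Finset V)} (hF : IsComplexFamily F) :
    complexOf A = F ↔ F ⊆ A ∧ Disjoint (externalFaces F) A := by
  constructor
  · rintro rfl
    refine ⟨fun σ hσ => ?_, Finset.disjoint_left.2 fun σ hσ hA => ?_⟩
    · exact (mem_complexOf.1 hσ).2 σ subset_rfl (mem_complexOf.1 hσ).1
    · simp only [externalFaces, mem_filter, mem_univ, true_and] at hσ
      refine hσ.1 (mem_complexOf.2 ⟨hσ.2.1, fun τ hτ hn => ?_⟩)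
      rcases hτ.eq_or_ssubset with rfl | h
      · exact hA
      · exact (mem_complexOf.1 (hσ.2.2 τ h hn)).2 τ subset_rfl hn
  · rintro ⟨hFA, hdis⟩
    have key : ∀ σ : Finset V, σ ∈ complexOf A → σ ∈ F := by
      intro σ
      induction σ using Finset.strongInduction with
      | H σ ih =>
        intro hσ
        by_contra hn
        refine Finset.disjoint_left.1 hdis ?_
          ((mem_complexOf.1 hσ).2 σ subset_rfl (mem_complexOf.1 hσ).1)
        simp only [externalFaces, mem_filter, mem_univ, true_and]
        exact ⟨hn, (mem_complexOf.1 hσ).1, fun τ hτ htn =>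
          ih τ hτ ((isComplexFamily_complexOf A).2 σ hσ τ hτ.subset htn)⟩
    refine Finset.Subset.antisymm (fun σ => key σ) fun σ hσ => mem_complexOf.2 ⟨?_, fun τ hτ hn => ?_⟩
    · exact Finset.nonempty_iff_ne_empty.2 fun h => hF.1 (h ▸ hσ)
    · exact hFA (hF.2 σ hσ τ hτ hn)

/-- The probability that the trials succeed on all of `B` and fail on all of `E`. -/
lemma sum_trialWeight_cylinder (pr : Finset V → ℝ) {B E : Finset (Finset V)}
    (hB : B ⊆ univ.erase ∅) (hE : E ⊆ univ.erase ∅) (hBE : Disjoint B E) :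
    ∑ A ∈ (univ.erase ∅).powerset with B ⊆ A ∧ Disjoint E A, trialWeight pr A =
      (∏ σ ∈ B, pr σ) * ∏ σ ∈ E, (1 - pr σ) := by
  have h := Finset.prod_add (fun σ => if σ ∈ E then 0 else pr σ)
    (fun σ => if σ ∈ B then 0 else 1 - pr σ) (univ.erase (∅ : Finset V))
  have hterm : ∀ A ∈ (univ.erase (∅ : Finset V)).powerset,
      (∏ σ ∈ A, if σ ∈ E then 0 else pr σ) *
        ∏ σ ∈ univ.erase ∅ \ A, (if σ ∈ B then 0 else 1 - pr σ) =
      if B ⊆ A ∧ Disjoint E A then trialWeight pr A else 0 := by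
    intro A _
    split_ifs with hA
    · unfold trialWeight
      congr 1
      · exact Finset.prod_congr rfl fun σ hσ =>
          if_neg fun hσE => Finset.disjoint_left.1 hA.2 hσE hσ
      · exact Finset.prod_congr rfl fun σ hσ =>
          if_neg fun hσB => (Finset.mem_sdiff.1 hσ).2 (hA.1 hσB)
    · rw [not_and_or, Finset.not_subset, Finset.not_disjoint_iff] at hA
      rcases hA with ⟨σ, hσB, hσA⟩ | ⟨σ, hσE, hσA⟩
      · refine mul_eq_zero_of_right _ ?_
        exact Finset.prod_eq_zero (Finset.mem_sdiff.2 ⟨hB hσB, hσA⟩) (if_pos hσB)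
      · refine mul_eq_zero_of_left ?_ _
        exact Finset.prod_eq_zero hσA (if_pos hσE)
  rw [Finset.sum_congr rfl hterm, ← Finset.sum_filter] at h
  rw [← h, ← Finset.prod_subset (Finset.union_subset hB hE)]
  · rw [Finset.prod_union hBE]
    congr 1
    · exact Finset.prod_congr rfl fun σ hσ => by
        simp [hσ, Finset.disjoint_left.1 hBE hσ]
    · exact Finset.prod_congr rfl fun σ hσ => by
        simp [hσ, Finset.disjoint_right.1 hBE hσ]
  · intro σ _ hσ
    simp only [Finset.mem_union, not_or] at hσ
    simp [hσ.1, hσ.2]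

lemma sum_trialWeight (pr : Finset V → ℝ) :
    ∑ A ∈ (univ.erase ∅).powerset, trialWeight pr A = 1 := by
  simpa using sum_trialWeight_cylinder pr (B := ∅) (E := ∅) (by simp) (by simp) (by simp)

lemma sum_trialWeight_superset (pr : Finset V → ℝ) {B : Finset (Finset V)}
    (hB : B ⊆ univ.erase ∅) :
    ∑ A ∈ (univ.erase ∅).powerset, trialWeight pr A * (if B ⊆ A then 1 else 0) =
      ∏ σ ∈ B, pr σ := by
  have h := sum_trialWeight_cylinder pr (E := ∅) hB (by simp) (by simp)
  simpa [Finset.sum_filter] using h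

lemma complexProb_eq_sum_trialWeight (pr : Finset V → ℝ) {F : Finset (Finset V)}
    (hF : IsComplexFamily F) :
    complexProb pr F =
      ∑ A ∈ (univ.erase ∅).powerset with complexOf A = F, trialWeight pr A := by
  simp only [complexOf_eq_iff hF]
  refine (sum_trialWeight_cylinder pr ?_ ?_ ?_).symm
  · intro σ hσ
    simp only [mem_erase, mem_univ, and_true]
    rintro rfl
    exact hF.1 hσ
  · intro σ hσ
    simp only [externalFaces, mem_filter, mem_univ, true_and] at hσ
    simpa using hσ.2.1.ne_empty
  · rw [Finset.disjoint_right]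
    intro σ hσ
    simp only [externalFaces, mem_filter, mem_univ, true_and] at hσ
    exact hσ.1

lemma sum_complexProb_filter (pr : Finset V → ℝ) (Q : Finset (Finset V) → Prop) :
    ∑ F ∈ univ.filter (fun F => IsComplexFamily F ∧ Q F), complexProb pr F =
      ∑ A ∈ (univ.erase ∅).powerset with Q (complexOf A), trialWeight pr A := by
  have hmaps : ∀ A ∈ (univ.erase (∅ : Finset V)).powerset.filter (fun A => Q (complexOf A)),
      complexOf A ∈ univ.filter (fun F : Finset (Finset V) => IsComplexFamily F ∧ Q F) := by
    intro A hA
    simpa using ⟨isComplexFamily_complexOf A, (Finset.mem_filter.1 hA).2⟩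
  rw [← Finset.sum_fiberwise_of_maps_to hmaps]
  refine Finset.sum_congr rfl fun F hF => ?_
  simp only [mem_filter, mem_univ, true_and] at hF
  rw [complexProb_eq_sum_trialWeight pr hF.1, Finset.filter_filter]
  refine Finset.sum_congr (Finset.filter_congr fun A _ => ?_) fun _ _ => rfl
  exact ⟨fun h => ⟨h ▸ hF.2, h⟩, fun h => h.2⟩

end Probability

section Cones

variable {V : Type*}

/-- The sets `insert u ρ` with `ρ ⊆ U`. -/
noncomputable def coneFamily (U : Finset V) (u : V) : Finset (Finset V) :=
  U.powerset.image (insert u)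

lemma mem_coneFamily {U σ : Finset V} {u : V} :
    σ ∈ coneFamily U u ↔ ∃ ρ ⊆ U, insert u ρ = σ := by
  simp [coneFamily]

lemma coneFamily_subset [Fintype V] (U : Finset V) (u : V) : coneFamily U u ⊆ univ.erase ∅ := by
  intro σ hσ
  obtain ⟨ρ, -, rfl⟩ := mem_coneFamily.1 hσ
  simp

lemma disjoint_coneFamily {U : Finset V} {u v : V} (hu : u ∉ U) (huv : u ≠ v) :
    Disjoint (coneFamily U u) (coneFamily U v) := by
  rw [Finset.disjoint_left]
  intro σ hσ hσ'
  obtain ⟨ρ, hρ, rfl⟩ := mem_coneFamily.1 hσ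
  obtain ⟨ρ', hρ', h⟩ := mem_coneFamily.1 hσ'
  have : u ∈ insert v ρ' := h ▸ Finset.mem_insert_self u ρ
  rcases Finset.mem_insert.1 this with h | h
  · exact huv h
  · exact hu (hρ' h)

lemma pow_le_prod_coneFamily {p P : ℝ} {pr : Finset V → ℝ} (hp : 0 < p) (hp1 : p ≤ 1)
    (hpr : ∀ σ : Finset V, σ.Nonempty → p ≤ pr σ ∧ pr σ ≤ P) (U : Finset V) (u : V) :
    p ^ 2 ^ U.card ≤ ∏ σ ∈ coneFamily U u, pr σ := by
  calc p ^ 2 ^ U.card ≤ p ^ (coneFamily U u).card := by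
        refine pow_le_pow_of_le_one hp.le hp1 ?_
        exact Finset.card_image_le.trans (Finset.card_powerset U).le
    _ = ∏ σ ∈ coneFamily U u, p := by simp
    _ ≤ _ := Finset.prod_le_prod (fun _ _ => hp.le) fun σ hσ => (hpr σ (by
        obtain ⟨ρ, -, rfl⟩ := mem_coneFamily.1 hσ
        exact Finset.insert_nonempty _ _)).1

end Cones

section Probability

variable {V : Type*} [Fintype V]

lemma insert_mem_complexOf {A : Finset (Finset V)} {U : Finset V} {u : V}
    (h : coneFamily U u ⊆ A) {ρ : Finset V} (hρU : ρ ⊆ U) (hρ : ρ = ∅ ∨ ρ ∈ complexOf A) :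
    insert u ρ ∈ complexOf A := by
  refine mem_complexOf.2 ⟨Finset.insert_nonempty _ _, fun τ hτ hn => ?_⟩
  by_cases hu : u ∈ τ
  · refine h (mem_coneFamily.2 ⟨τ.erase u, ?_, Finset.insert_erase hu⟩)
    exact (Finset.subset_insert_iff.1 hτ).trans hρU
  · have hτρ : τ ⊆ ρ := (Finset.subset_insert_iff_of_notMem hu).1 hτ
    rcases hρ with rfl | hρ
    · exact absurd (Finset.subset_empty.1 hτρ) hn.ne_empty
    · exact (mem_complexOf.1 hρ).2 τ hτρ hn

/-- The cones with base `U` and distinct apexes are present independently of each other. -/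
lemma sum_trialWeight_no_cone (pr : Finset V → ℝ) (U : Finset V) :
    ∑ A ∈ (univ.erase ∅).powerset, trialWeight pr A *
        ∏ u ∈ Uᶜ, (1 - if coneFamily U u ⊆ A then 1 else 0) =
      ∏ u ∈ Uᶜ, (1 - ∏ σ ∈ coneFamily U u, pr σ) := by
  simp only [sub_eq_add_neg, Finset.prod_one_add, Finset.mul_sum]
  rw [Finset.sum_comm]
  refine Finset.sum_congr rfl fun S hS => ?_
  have hSU := Finset.mem_powerset.1 hS
  simp only [Finset.prod_neg]
  have hdis : (S : Set V).PairwiseDisjoint (coneFamily U) := fun u hu v _ huv =>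
    disjoint_coneFamily (Finset.mem_compl.1 (hSU hu)) huv
  rw [← Finset.prod_biUnion hdis, ← sum_trialWeight_superset pr (B := S.biUnion (coneFamily U))
    (Finset.biUnion_subset.2 fun u _ => coneFamily_subset U u), Finset.mul_sum]
  refine Finset.sum_congr rfl fun A _ => ?_
  have : (∏ u ∈ S, if coneFamily U u ⊆ A then (1 : ℝ) else 0) =
      if S.biUnion (coneFamily U) ⊆ A then 1 else 0 := by
    rw [Finset.prod_ite_zero]
    simp
  rw [this]
  ring

variable {p P : ℝ} {pr : Finset V → ℝ}

lemma trialWeight_nonneg (hp : 0 < p) (hP : P < 1)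
    (hpr : ∀ σ : Finset V, σ.Nonempty → p ≤ pr σ ∧ pr σ ≤ P)
    {A : Finset (Finset V)} (hA : A ∈ (univ.erase (∅ : Finset V)).powerset) :
    0 ≤ trialWeight pr A := by
  have hne : ∀ σ ∈ univ.erase (∅ : Finset V), σ.Nonempty := fun σ hσ =>
    Finset.nonempty_iff_ne_empty.2 (Finset.mem_erase.1 hσ).1
  refine mul_nonneg (Finset.prod_nonneg fun σ hσ => ?_) (Finset.prod_nonneg fun σ hσ => ?_)
  · linarith [hpr σ (hne σ (Finset.mem_powerset.1 hA hσ))]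
  · linarith [hpr σ (hne σ (Finset.mem_sdiff.1 hσ).1)]

/-- Every set of at most `R` vertices is the base of a cone: some vertex `u` can be added to
every face contained in that set. -/
def HasCones (F : Finset (Finset V)) (R : ℕ) : Prop :=
  ∀ U : Finset V, U.card ≤ R → ∃ u, ∀ ρ ⊆ U, ρ = ∅ ∨ ρ ∈ F → insert u ρ ∈ F

lemma one_sub_le_sum_trialWeight_hasCones (hp : 0 < p) (hpP : p < P) (hP : P < 1)
    (hpr : ∀ σ : Finset V, σ.Nonempty → p ≤ pr σ ∧ pr σ ≤ P) {R : ℕ}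
    (hR : R ≤ Fintype.card V) :
    1 - (Fintype.card V : ℝ) ^ R * (1 - p ^ 2 ^ R) ^ (Fintype.card V - R) ≤
      ∑ A ∈ (univ.erase (∅ : Finset V)).powerset with HasCones (complexOf A) R,
        trialWeight pr A := by
  have hsplit := Finset.sum_filter_add_sum_filter_not (univ.erase (∅ : Finset V)).powerset
    (fun A => HasCones (complexOf A) R) (trialWeight pr)
  rw [sum_trialWeight] at hsplit
  set failure : Finset V → Finset (Finset V) → ℝ := fun U A =>
    ∏ u ∈ Uᶜ, (1 - if coneFamily U u ⊆ A then 1 else 0) with hfailure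
  have hnonneg : ∀ U A, 0 ≤ failure U A := fun U A =>
    Finset.prod_nonneg fun u _ => by split_ifs <;> norm_num
  have hone : ∀ A, ¬ HasCones (complexOf A) R →
      1 ≤ ∑ U ∈ Finset.powersetCard R univ, failure U A := by
    intro A hA
    simp only [HasCones, not_forall, not_exists] at hA
    obtain ⟨U₀, hU₀, hno⟩ := hA
    obtain ⟨U, hU₀U, -, hU⟩ := Finset.exists_subsuperset_card_eq (Finset.subset_univ U₀) hU₀
      (by simpa using hR)
    have hfail : failure U A = 1 := by
      refine Finset.prod_eq_one fun u _ => ?_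
      rw [if_neg, sub_zero]
      intro hsub
      obtain ⟨ρ, hρ, hρ', hρn⟩ := by simpa only [not_forall] using hno u
      exact hρn (insert_mem_complexOf hsub (hρ.trans hU₀U) hρ')
    rw [← hfail]
    exact Finset.single_le_sum (f := fun U => failure U A) (fun U _ => hnonneg U A)
      (Finset.mem_powersetCard.2 ⟨Finset.subset_univ U, hU⟩)
  have hp1 : p ≤ 1 := by linarith
  have hbound : ∀ U ∈ Finset.powersetCard R (univ : Finset V),
      ∑ A ∈ (univ.erase (∅ : Finset V)).powerset, trialWeight pr A * failure U A ≤
        (1 - p ^ 2 ^ R) ^ (Fintype.card V - R) := by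
    intro U hU
    have hcard := (Finset.mem_powersetCard.1 hU).2
    rw [hfailure, sum_trialWeight_no_cone, ← hcard, ← Finset.card_compl]
    rw [← Finset.prod_const]
    refine Finset.prod_le_prod (fun u _ => ?_) fun u _ => ?_
    · refine sub_nonneg.2 (Finset.prod_le_one (fun σ hσ => ?_) fun σ hσ => ?_) <;>
      · obtain ⟨ρ, -, rfl⟩ := mem_coneFamily.1 hσ
        linarith [hpr _ (Finset.insert_nonempty u ρ)]
    · linarith [pow_le_prod_coneFamily hp hp1 hpr U u]
  have hbad : ∑ A ∈ (univ.erase (∅ : Finset V)).powerset with ¬ HasCones (complexOf A) R,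
      trialWeight pr A ≤
        (Fintype.card V : ℝ) ^ R * (1 - p ^ 2 ^ R) ^ (Fintype.card V - R) := by
    have hq : 0 ≤ (1 - p ^ 2 ^ R) ^ (Fintype.card V - R) :=
      pow_nonneg (sub_nonneg.2 (pow_le_one₀ hp.le hp1)) _
    calc _ ≤ ∑ A ∈ (univ.erase (∅ : Finset V)).powerset with ¬ HasCones (complexOf A) R,
          trialWeight pr A * ∑ U ∈ Finset.powersetCard R univ, failure U A := by
          refine Finset.sum_le_sum fun A hA => ?_
          rw [Finset.mem_filter] at hA
          exact le_mul_of_one_le_right (trialWeight_nonneg hp hP hpr hA.1) (hone A hA.2)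
      _ ≤ ∑ A ∈ (univ.erase (∅ : Finset V)).powerset,
          trialWeight pr A * ∑ U ∈ Finset.powersetCard R univ, failure U A :=
          Finset.sum_le_sum_of_subset_of_nonneg (Finset.filter_subset _ _) fun A hA _ =>
            mul_nonneg (trialWeight_nonneg hp hP hpr hA)
              (Finset.sum_nonneg fun U _ => hnonneg U A)
      _ = ∑ U ∈ Finset.powersetCard R univ, ∑ A ∈ (univ.erase (∅ : Finset V)).powerset,
          trialWeight pr A * failure U A := by
          simp only [Finset.mul_sum]
          exact Finset.sum_comm
      _ ≤ ∑ U ∈ Finset.powersetCard R (univ : Finset V),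
          (1 - p ^ 2 ^ R) ^ (Fintype.card V - R) := Finset.sum_le_sum hbound
      _ ≤ _ := by
          rw [Finset.sum_const, nsmul_eq_mul, Finset.card_powersetCard, Finset.card_univ]
          refine mul_le_mul_of_nonneg_right ?_ hq
          exact_mod_cast Nat.choose_le_pow _ _
  linarith

lemma tendsto_pow_mul_pow_sub (R : ℕ) {q : ℝ} (hq0 : 0 < q) (hq1 : q < 1) :
    Filter.Tendsto (fun n : ℕ => (n : ℝ) ^ R * q ^ (n - R)) Filter.atTop (nhds 0) := by
  have h := (tendsto_pow_const_mul_const_pow_of_lt_one R hq0.le hq1).mul_const (q ^ R)⁻¹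
  rw [zero_mul] at h
  refine h.congr' ?_
  filter_upwards [Filter.eventually_ge_atTop R] with n hn
  rw [pow_sub₀ q hq0.ne' hn, mul_assoc]

end Probability

section Cones

variable {V : Type*}

/-- Apexes `u σ` chosen recursively, such that `u σ` is the apex provided by `c` for the set formed
by `σ` and the apexes of the proper subsets of `σ`. -/
noncomputable def coneVertex (c : Finset V → V) (σ : Finset V) : V :=
  c (σ ∪ σ.ssubsets.attach.image fun τ => coneVertex c τ.1)
termination_by σ.card
decreasing_by exact Finset.card_lt_card (Finset.mem_ssubsets.1 τ.2)

lemma HasCones.exists_coneVertex {F : Finset (Finset V)} {M : ℕ}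
    (hF : HasCones F (M + 2 ^ M)) :
    ∃ u : Finset V → V, ∀ σ : Finset V, σ.card ≤ M →
      ∀ ρ ⊆ σ ∪ σ.ssubsets.image u, ρ = ∅ ∨ ρ ∈ F → insert (u σ) ρ ∈ F := by
  have hF' : ∀ U : Finset V, ∃ u, U.card ≤ M + 2 ^ M →
      ∀ ρ ⊆ U, ρ = ∅ ∨ ρ ∈ F → insert u ρ ∈ F := fun U => by
    by_cases hU : U.card ≤ M + 2 ^ M
    · obtain ⟨u, hu⟩ := hF U hU
      exact ⟨u, fun _ => hu⟩
    · obtain ⟨u, -⟩ := hF ∅ (by simp)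
      exact ⟨u, fun h => absurd h hU⟩
  choose c hc using hF'
  refine ⟨coneVertex c, fun σ hσ => ?_⟩
  have hu : coneVertex c σ = c (σ ∪ σ.ssubsets.image (coneVertex c)) := by
    rw [coneVertex]
    congr 2
    ext v
    simp
  rw [hu]
  refine hc _ ((Finset.card_union_le _ _).trans (Nat.add_le_add hσ ?_))
  calc (σ.ssubsets.image (coneVertex c)).card ≤ σ.ssubsets.card := Finset.card_image_le
    _ ≤ σ.powerset.card := Finset.card_le_card (Finset.erase_subset _ _)
    _ ≤ 2 ^ M := by
        rw [Finset.card_powerset]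
        exact Nat.pow_le_pow_right two_pos hσ

/-- The apexes of the members of a chain span a face, even after joining a face contained in all
members of the chain. -/
lemma union_image_mem_of_chain {F : Finset (Finset V)} {M : ℕ} {u : Finset V → V}
    (hu : ∀ σ : Finset V, σ.card ≤ M →
      ∀ ρ ⊆ σ ∪ σ.ssubsets.image u, ρ = ∅ ∨ ρ ∈ F → insert (u σ) ρ ∈ F)
    {ρ : Finset V} (hρ : ρ = ∅ ∨ ρ ∈ F) (C : Finset (Finset V))
    (hchain : ∀ σ ∈ C, ∀ τ ∈ C, σ ⊆ τ ∨ τ ⊆ σ) (hcard : ∀ σ ∈ C, σ.card ≤ M)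
    (hρC : ∀ σ ∈ C, ρ ⊆ σ) :
    ρ ∪ C.image u = ∅ ∨ ρ ∪ C.image u ∈ F := by
  induction C using Finset.induction_on_max_value (ι := Finset V) Finset.card with
  | empty => simpa using hρ
  | insert σ C hσC hmax ih =>
    have ih' := ih (fun α hα β hβ => hchain α (mem_insert_of_mem hα) β (mem_insert_of_mem hβ))
      (fun α hα => hcard α (mem_insert_of_mem hα)) (fun α hα => hρC α (mem_insert_of_mem hα))
    right
    rw [Finset.image_insert, Finset.union_insert]
    refine hu σ (hcard σ (mem_insert_self _ _)) _ ?_ ih'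
    refine Finset.union_subset_union (hρC σ (mem_insert_self _ _))
      (Finset.image_subset_image fun τ hτ => Finset.mem_ssubsets.2 ?_)
    have hne : τ ≠ σ := fun h => hσC (h ▸ hτ)
    rcases hchain τ (mem_insert_of_mem hτ) σ (mem_insert_self _ _) with h | h
    · exact h.ssubset_of_ne hne
    · exact absurd (Finset.eq_of_subset_of_card_le h (hmax τ hτ)).symm hne

end Cones

section Realization

variable {V : Type*} [Fintype V]

/-- The set of coordinates at which `x` is positive. -/
noncomputable def posSupport (x : V → ℝ) : Finset V := univ.filter fun v => 0 < x v

lemma mem_posSupport {x : V → ℝ} {v : V} : v ∈ posSupport x ↔ 0 < x v := by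
  simp [posSupport]

lemma mem_realizationOf_iff {F : Finset (Finset V)} (hF : IsComplexFamily F) {x : V → ℝ} :
    x ∈ realizationOf (F : Set (Finset V)) ↔
      (∀ v, 0 ≤ x v) ∧ ∑ v, x v = 1 ∧ posSupport x ∈ F := by
  constructor
  · rintro ⟨σ, hσ, h0, hout, hsum⟩
    have hsum' : ∑ v, x v = 1 := by
      rw [← hsum]
      exact (Finset.sum_subset (Finset.subset_univ σ) fun v _ hv => hout v hv).symm
    refine ⟨h0, hsum', hF.2 σ hσ _ (fun v hv => ?_) ?_⟩
    · by_contra hvσ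
      exact (mem_posSupport.1 hv).ne' (hout v hvσ)
    · obtain ⟨v, -, hv⟩ := Finset.exists_ne_zero_of_sum_ne_zero (hsum'.trans_ne one_ne_zero)
      exact ⟨v, mem_posSupport.2 ((h0 v).lt_of_ne' hv)⟩
  · rintro ⟨h0, hsum, hσ⟩
    have hout : ∀ v, v ∉ posSupport x → x v = 0 := fun v hv =>
      le_antisymm (not_lt.1 fun h => hv (mem_posSupport.2 h)) (h0 v)
    refine ⟨_, hσ, h0, hout, ?_⟩
    rw [← hsum]
    exact Finset.sum_subset (Finset.subset_univ _) fun v _ hv => hout v hv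

/-- Rescaling to coordinate sum one. -/
noncomputable def normalized (y : V → ℝ) : V → ℝ := fun v => y v / ∑ w, y w

lemma sum_normalized {y : V → ℝ} (hy : 0 < ∑ w, y w) : ∑ v, normalized y v = 1 := by
  simp only [normalized]
  rw [← Finset.sum_div, div_self hy.ne']

lemma normalized_nonneg {y : V → ℝ} (hy : ∀ v, 0 ≤ y v) (v : V) : 0 ≤ normalized y v :=
  div_nonneg (hy v) (Finset.sum_nonneg fun w _ => hy w)

lemma posSupport_normalized {y : V → ℝ} (hy : 0 < ∑ w, y w) :
    posSupport (normalized y) = posSupport y := by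
  ext v
  simp [mem_posSupport, normalized, hy]

lemma normalized_eq_self {y : V → ℝ} (hy : ∑ w, y w = 1) : normalized y = y := by
  ext v
  simp [normalized, hy]

lemma continuous_normalized {Y : Type*} [TopologicalSpace Y] {y : Y → V → ℝ}
    (hy : Continuous y) (h0 : ∀ z, 0 < ∑ w, y z w) : Continuous fun z => normalized (y z) := by
  refine continuous_pi fun v => ?_
  simp only [normalized]
  exact ((continuous_apply v).comp hy).div
    (continuous_finsetSum _ fun w _ => (continuous_apply w).comp hy) fun z => (h0 z).ne'

/-- Two maps into a realization are homotopic when every value of the second lies in the carrier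
of the corresponding value of the first. -/
lemma homotopic_of_posSupport_subset {F : Finset (Finset V)} (hF : IsComplexFamily F)
    {Y : Type*} [TopologicalSpace Y] (f g : C(Y, ↥(realizationOf (F : Set (Finset V)))))
    (h : ∀ y, posSupport (g y).1 ⊆ posSupport (f y).1) : f.Homotopic g := by
  have hmem : ∀ z : unitInterval × Y,
      (fun v => (1 - (z.1 : ℝ)) * (f z.2).1 v + z.1 * (g z.2).1 v) ∈
        realizationOf (F : Set (Finset V)) := by
    rintro ⟨t, y⟩
    obtain ⟨f0, f1, fF⟩ := (mem_realizationOf_iff hF).1 (f y).2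
    obtain ⟨g0, g1, gF⟩ := (mem_realizationOf_iff hF).1 (g y).2
    have ht0 := t.2.1
    have ht1 : 0 ≤ 1 - (t : ℝ) := sub_nonneg.2 t.2.2
    refine (mem_realizationOf_iff hF).2
      ⟨fun v => add_nonneg (mul_nonneg ht1 (f0 v)) (mul_nonneg ht0 (g0 v)), ?_, ?_⟩
    · simp only [Finset.sum_add_distrib, ← Finset.mul_sum, f1, g1]
      ring
    · refine hF.2 _ fF _ (fun v hv => ?_) ?_
      · rw [mem_posSupport] at hv
        by_contra hvf
        have hvg : v ∉ posSupport (g y).1 := fun hvg => hvf (h y hvg)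
        rw [mem_posSupport, not_lt] at hvf hvg
        nlinarith [mul_nonneg ht1 (f0 v), mul_nonneg ht0 (g0 v),
          mul_nonneg ht1 (sub_nonneg.2 hvf), mul_nonneg ht0 (sub_nonneg.2 hvg)]
      · by_contra hempty
        rw [Finset.not_nonempty_iff_eq_empty] at hempty
        have hle : ∀ v, (1 - (t : ℝ)) * (f y).1 v + t * (g y).1 v ≤ 0 := fun v =>
          not_lt.1 fun hv => by
            exact Finset.notMem_empty v (hempty ▸ mem_posSupport.2 hv)
        have := Finset.sum_nonpos fun v (_ : v ∈ univ) => hle v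
        simp only [Finset.sum_add_distrib, ← Finset.mul_sum, f1, g1] at this
        linarith
  refine ⟨⟨⟨fun z => ⟨_, hmem z⟩, ?_⟩, fun y => ?_, fun y => ?_⟩⟩
  · refine Continuous.subtype_mk (continuous_pi fun v => ?_) _
    have hf : Continuous fun z : unitInterval × Y => (f z.2).1 v :=
      (continuous_apply v).comp (continuous_subtype_val.comp (f.continuous.comp continuous_snd))
    have hg : Continuous fun z : unitInterval × Y => (g z.2).1 v :=
      (continuous_apply v).comp (continuous_subtype_val.comp (g.continuous.comp continuous_snd))
    exact ((by fun_prop : Continuous fun z : unitInterval × Y => 1 - (z.1 : ℝ)).mul hf).add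
      ((by fun_prop : Continuous fun z : unitInterval × Y => (z.1 : ℝ)).mul hg)
  · ext v
    simp
  · ext v
    simp

/-- A continuous weight which is positive exactly when `σ` is a superlevel set of `x` at
some level in `[0, s)`. -/
noncomputable def levelWeight (σ : Finset V) (s : ℝ) (x : V → ℝ) : ℝ :=
  s * ((∏ v ∈ σ, x v) * ((∏ v ∈ σ, ∏ w ∈ σᶜ, max (x v - x w) 0) * ∏ w ∈ σᶜ, max (s - x w) 0))

lemma levelWeight_nonneg {σ : Finset V} {s : ℝ} {x : V → ℝ} (hs : 0 ≤ s) (hx : ∀ v, 0 ≤ x v) :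
    0 ≤ levelWeight σ s x := by
  refine mul_nonneg hs (mul_nonneg (Finset.prod_nonneg fun v _ => hx v) (mul_nonneg ?_ ?_))
  · exact Finset.prod_nonneg fun v _ => Finset.prod_nonneg fun w _ => le_max_right _ _
  · exact Finset.prod_nonneg fun w _ => le_max_right _ _

lemma levelWeight_posSupport_pos {s : ℝ} {x : V → ℝ} (hs : 0 < s) :
    0 < levelWeight (posSupport x) s x := by
  have hout : ∀ w ∈ (posSupport x)ᶜ, x w ≤ 0 := fun w hw =>
    not_lt.1 fun h => Finset.mem_compl.1 hw (mem_posSupport.2 h)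
  refine mul_pos hs (mul_pos (Finset.prod_pos fun v hv => mem_posSupport.1 hv) (mul_pos ?_ ?_))
  · refine Finset.prod_pos fun v hv => Finset.prod_pos fun w hw => lt_max_of_lt_left ?_
    linarith [mem_posSupport.1 hv, hout w hw]
  · refine Finset.prod_pos fun w hw => lt_max_of_lt_left ?_
    linarith [hout w hw]

lemma of_levelWeight_ne_zero {σ : Finset V} {s : ℝ} {x : V → ℝ} (h : levelWeight σ s x ≠ 0) :
    (∀ v ∈ σ, x v ≠ 0) ∧ (∀ v ∈ σ, ∀ w ∉ σ, x w < x v) ∧ ∀ w ∉ σ, x w < s := by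
  simp only [levelWeight, mul_ne_zero_iff, Finset.prod_ne_zero_iff, Finset.mem_compl] at h
  refine ⟨h.2.1, fun v hv w hw => ?_, fun w hw => ?_⟩
  · by_contra hle
    exact h.2.2.1 v hv w hw (max_eq_right (by linarith))
  · by_contra hle
    exact h.2.2.2 w hw (max_eq_right (by linarith))

/-- The part of `x` above level `s`, together with the superlevel sets `σ` of `x` at levels below
`s`, each contributing mass at the vertex `u σ`. -/
noncomputable def levelPush (u : Finset V → V) (s : ℝ) (x : V → ℝ) : V → ℝ := fun w =>
  max (x w - s) 0 + ∑ σ with σ.Nonempty ∧ u σ = w, levelWeight σ s x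

lemma levelPush_nonneg (u : Finset V → V) {s : ℝ} {x : V → ℝ} (hs : 0 ≤ s)
    (hx : ∀ v, 0 ≤ x v) (w : V) : 0 ≤ levelPush u s x w :=
  add_nonneg (le_max_right _ _) (Finset.sum_nonneg fun _ _ => levelWeight_nonneg hs hx)

lemma levelPush_zero (u : Finset V → V) {x : V → ℝ} (hx : ∀ v, 0 ≤ x v) :
    levelPush u 0 x = x := by
  ext w
  simp [levelPush, levelWeight, hx w]

lemma posSupport_nonempty {x : V → ℝ} (hsum : 0 < ∑ v, x v) : (posSupport x).Nonempty := by
  obtain ⟨v, -, hv⟩ := Finset.exists_lt_of_sum_lt (s := univ) (f := fun _ => (0 : ℝ)) (g := x)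
    (by simpa using hsum)
  exact ⟨v, mem_posSupport.2 hv⟩

lemma sum_levelPush_pos (u : Finset V → V) {s : ℝ} {x : V → ℝ} (hs : 0 ≤ s)
    (hx : ∀ v, 0 ≤ x v) (hsum : ∑ v, x v = 1) : 0 < ∑ w, levelPush u s x w := by
  rcases hs.eq_or_lt with rfl | hs'
  · rw [levelPush_zero u hx, hsum]
    exact one_pos
  · refine Finset.sum_pos' (fun w _ => levelPush_nonneg u hs hx w)
      ⟨u (posSupport x), mem_univ _, add_pos_of_nonneg_of_pos (le_max_right _ _) ?_⟩
    refine Finset.sum_pos' (fun _ _ => levelWeight_nonneg hs hx)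
      ⟨posSupport x, ?_, levelWeight_posSupport_pos hs'⟩
    simpa using posSupport_nonempty (hsum ▸ one_pos)

lemma continuous_levelPush (u : Finset V → V) :
    Continuous fun z : ℝ × (V → ℝ) => levelPush u z.1 z.2 := by
  unfold levelPush levelWeight
  fun_prop

lemma normalized_levelPush_mem {F : Finset (Finset V)} (hF : IsComplexFamily F) {M : ℕ}
    {u : Finset V → V}
    (hu : ∀ σ : Finset V, σ.card ≤ M →
      ∀ ρ ⊆ σ ∪ σ.ssubsets.image u, ρ = ∅ ∨ ρ ∈ F → insert (u σ) ρ ∈ F)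
    {s : ℝ} (hs : 0 ≤ s) {x : V → ℝ} (hx : ∀ v, 0 ≤ x v) (hsum : ∑ v, x v = 1)
    (hcard : (posSupport x).card ≤ M) (h : posSupport x ∈ F ∨ s = 1) :
    normalized (levelPush u s x) ∈ realizationOf (F : Set (Finset V)) := by
  have hpos := sum_levelPush_pos u hs hx hsum
  refine (mem_realizationOf_iff hF).2
    ⟨normalized_nonneg (levelPush_nonneg u hs hx), sum_normalized hpos, ?_⟩
  rw [posSupport_normalized hpos]
  set ρ : Finset V := univ.filter fun v => s < x v with hρdef
  set C : Finset (Finset V) := univ.filter fun σ => levelWeight σ s x ≠ 0 with hCdef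
  have hC : ∀ σ ∈ C, levelWeight σ s x ≠ 0 := fun σ hσ => (Finset.mem_filter.1 hσ).2
  have hρ : ρ = ∅ ∨ ρ ∈ F := by
    rcases ρ.eq_empty_or_nonempty with hρ | hρ
    · exact Or.inl hρ
    · rcases h with h | rfl
      · refine Or.inr (hF.2 _ h _ (fun v hv => ?_) hρ)
        exact mem_posSupport.2 (hs.trans_lt (Finset.mem_filter.1 hv).2)
      · obtain ⟨v, hv⟩ := hρ
        have := Finset.single_le_sum (f := x) (fun w _ => hx w) (mem_univ v)
        exact absurd ((Finset.mem_filter.1 hv).2.trans_le (this.trans hsum.le)) (lt_irrefl _)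
  have hface := union_image_mem_of_chain hu hρ C
    (fun σ hσ τ hτ => by
      by_contra hn
      rw [not_or, Finset.not_subset, Finset.not_subset] at hn
      obtain ⟨⟨v, hv, hv'⟩, w, hw, hw'⟩ := hn
      exact lt_asymm ((of_levelWeight_ne_zero (hC σ hσ)).2.1 v hv w hw')
        ((of_levelWeight_ne_zero (hC τ hτ)).2.1 w hw v hv'))
    (fun σ hσ => (Finset.card_le_card fun v hv => mem_posSupport.2
      ((hx v).lt_of_ne' ((of_levelWeight_ne_zero (hC σ hσ)).1 v hv))).trans hcard)
    (fun σ hσ v hv => by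
      by_contra hvσ
      exact lt_asymm (Finset.mem_filter.1 hv).2 ((of_levelWeight_ne_zero (hC σ hσ)).2.2 v hvσ))
  have hsub : posSupport (levelPush u s x) ⊆ ρ ∪ C.image u := by
    intro w hw
    rw [mem_posSupport] at hw
    by_contra hn
    rw [Finset.mem_union, not_or] at hn
    refine hw.ne' ?_
    have h1 : max (x w - s) 0 = 0 := by
      refine max_eq_right (sub_nonpos.2 (not_lt.1 fun hlt => hn.1 ?_))
      simpa [hρdef] using hlt
    rw [levelPush, h1, zero_add]
    refine Finset.sum_eq_zero fun σ hσ => ?_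
    by_contra hne
    exact hn.2 (Finset.mem_image.2 ⟨σ, by simpa [hCdef] using hne, (Finset.mem_filter.1 hσ).2.2⟩)
  have hne := posSupport_nonempty hpos
  rcases hface with hface | hface
  · exact absurd (Finset.subset_empty.1 (hface ▸ hsub)) hne.ne_empty
  · exact hF.2 _ hface _ hsub hne

/-- A map into a realization is nullhomotopic if it factors through a contractible space
after enlarging the target to the points of the full simplex with few positive coordinates. -/
lemma nullhomotopic_of_extension {F : Finset (Finset V)} (hF : IsComplexFamily F) {M : ℕ}
    (hcones : HasCones F (M + 2 ^ M)) {Y Z : Type*} [TopologicalSpace Y] [TopologicalSpace Z]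
    [ContractibleSpace Z] (i : C(Y, Z)) (G : C(Z, V → ℝ)) (hG0 : ∀ z v, 0 ≤ G z v)
    (hG1 : ∀ z, ∑ v, G z v = 1) (hGM : ∀ z, (posSupport (G z)).card ≤ M)
    (g : C(Y, ↥(realizationOf (F : Set (Finset V))))) (hg : ∀ y, (g y).1 = G (i y)) :
    g.Nullhomotopic := by
  obtain ⟨u, hu⟩ := hcones.exists_coneVertex
  have hcont : Continuous fun z : Z => normalized (levelPush u 1 (G z)) := by
    refine continuous_normalized ?_ fun z => sum_levelPush_pos u zero_le_one (hG0 z) (hG1 z)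
    exact (continuous_levelPush u).comp (continuous_const.prodMk G.continuous)
  let h : C(Z, ↥(realizationOf (F : Set (Finset V)))) :=
    ⟨fun z => ⟨_, normalized_levelPush_mem hF hu zero_le_one (hG0 z) (hG1 z) (hGM z)
      (Or.inr rfl)⟩, hcont.subtype_mk _⟩
  have hnull : (h.comp i).Nullhomotopic := by
    have := ((id_nullhomotopic Z).comp_left i).comp_right h
    simpa using this
  suffices hom : g.Homotopic (h.comp i) by
    obtain ⟨x, hx⟩ := hnull
    exact ⟨x, hom.trans hx⟩
  have hcont' : Continuous fun z : unitInterval × Y =>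
      normalized (levelPush u z.1 (G (i z.2))) := by
    refine continuous_normalized ?_ fun z =>
      sum_levelPush_pos u z.1.2.1 (hG0 (i z.2)) (hG1 (i z.2))
    exact (continuous_levelPush u).comp ((continuous_subtype_val.comp continuous_fst).prodMk
      (G.continuous.comp (i.continuous.comp continuous_snd)))
  have hmem : ∀ z : unitInterval × Y, normalized (levelPush u z.1 (G (i z.2))) ∈
      realizationOf (F : Set (Finset V)) := fun z => by
    refine normalized_levelPush_mem hF hu z.1.2.1 (hG0 _) (hG1 _) (hGM _) (Or.inl ?_)
    rw [← hg]
    exact ((mem_realizationOf_iff hF).1 (g z.2).2).2.2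
  refine ⟨⟨⟨fun z => ⟨_, hmem z⟩, hcont'.subtype_mk _⟩, fun y => ?_, fun y => rfl⟩⟩
  refine Subtype.ext ?_
  change normalized (levelPush u 0 (G (i y))) = (g y).1
  rw [levelPush_zero u (hG0 _), normalized_eq_self (hG1 _), hg]

end Realization

section Grid

variable {m : ℕ}

/-- The product of hat functions on `ℝᵐ` of width `1 / N` centred at `a / N`. -/
noncomputable def hat (N : ℕ) (a : Fin m → ℤ) (x : EuclideanSpace ℝ (Fin m)) : ℝ :=
  ∏ i, max (1 - |N * x i - a i|) 0

lemma hat_nonneg (N : ℕ) (a : Fin m → ℤ) (x : EuclideanSpace ℝ (Fin m)) : 0 ≤ hat N a x :=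
  Finset.prod_nonneg fun _ _ => le_max_right _ _

lemma hat_pos_iff {N : ℕ} {a : Fin m → ℤ} {x : EuclideanSpace ℝ (Fin m)} :
    0 < hat N a x ↔ ∀ i, |N * x i - a i| < 1 := by
  constructor
  · intro h i
    by_contra hi
    exact h.ne' (Finset.prod_eq_zero (mem_univ i) (max_eq_right (by linarith)))
  · exact fun h => Finset.prod_pos fun i _ => lt_max_of_lt_left (sub_pos.2 (h i))

lemma continuous_hat (N : ℕ) (a : Fin m → ℤ) : Continuous (hat N a) := by
  unfold hat
  fun_prop

/-- The grid points indexing the hat functions which do not vanish on the unit ball. -/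
noncomputable def gridBox (m N : ℕ) : Finset (Fin m → ℤ) :=
  Fintype.piFinset fun _ => Finset.Icc (-(N : ℤ)) N

lemma exists_hat_pos (N : ℕ) {x : EuclideanSpace ℝ (Fin m)} (hx : ‖x‖ ≤ 1) :
    ∃ a ∈ gridBox m N, 0 < hat N a x := by
  refine ⟨fun i => ⌊N * x i⌋, Fintype.mem_piFinset.2 fun i => Finset.mem_Icc.2 ?_,
    hat_pos_iff.2 fun i => ?_⟩
  · have hxi : |x i| ≤ 1 := (PiLp.norm_apply_le x i).trans hx
    have hN : (0 : ℝ) ≤ N := Nat.cast_nonneg N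
    obtain ⟨h1, h2⟩ := abs_le.1 hxi
    constructor
    · refine Int.le_floor.2 ?_
      push_cast
      nlinarith
    · have : (⌊N * x i⌋ : ℝ) ≤ N := (Int.floor_le _).trans (by nlinarith)
      exact_mod_cast this
  · rw [abs_lt]
    constructor <;> linarith [Int.floor_le (N * x i), Int.lt_floor_add_one (N * x i)]

lemma card_hat_pos_le (N : ℕ) (x : EuclideanSpace ℝ (Fin m)) :
    ((gridBox m N).filter fun a => 0 < hat N a x).card ≤ 2 ^ m := by
  calc _ ≤ (Fintype.piFinset fun i => ({⌊N * x i⌋, ⌊N * x i⌋ + 1} : Finset ℤ)).card := by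
        refine Finset.card_le_card fun a ha => Fintype.mem_piFinset.2 fun i => ?_
        have hi := abs_lt.1 (hat_pos_iff.1 (Finset.mem_filter.1 ha).2 i)
        have h1 : ⌊N * x i⌋ < a i + 1 := Int.floor_lt.2 (by push_cast; linarith)
        have h2 : a i - 1 ≤ ⌊N * x i⌋ := Int.le_floor.2 (by push_cast; linarith)
        simp only [Finset.mem_insert, Finset.mem_singleton]
        omega
    _ = ∏ i, ({⌊N * x i⌋, ⌊N * x i⌋ + 1} : Finset ℤ).card := Fintype.card_piFinset _
    _ ≤ ∏ _i : Fin m, 2 := Finset.prod_le_prod' fun i _ => Finset.card_le_two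
    _ = 2 ^ m := by simp

lemma exists_grid_fine (m : ℕ) {δ : ℝ} (hδ : 0 < δ) :
    ∃ N : ℕ, ∀ (a : Fin m → ℤ) (x y : EuclideanSpace ℝ (Fin m)),
      0 < hat N a x → 0 < hat N a y → dist x y < δ := by
  set K : NNReal := (Fintype.card (Fin m) : NNReal) ^ (1 / (2 : ENNReal)).toReal
  have hK : AntilipschitzWith K (@WithLp.ofLp 2 (Fin m → ℝ)) :=
    PiLp.antilipschitzWith_ofLp 2 fun _ : Fin m => ℝ
  obtain ⟨N, hN⟩ := exists_nat_gt (K * 2 / δ)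
  have hN0 : (0 : ℝ) < N := lt_of_le_of_lt (by positivity) hN
  refine ⟨N, fun a x y hx hy => ?_⟩
  have hle : dist x.ofLp y.ofLp ≤ 2 / N := by
    refine (dist_pi_le_iff (by positivity)).2 fun i => ?_
    have h1 := abs_lt.1 (hat_pos_iff.1 hx i)
    have h2 := abs_lt.1 (hat_pos_iff.1 hy i)
    rw [Real.dist_eq, abs_le, ← neg_div, div_le_iff₀ hN0, le_div_iff₀ hN0]
    constructor <;> linarith
  calc dist x y ≤ K * dist x.ofLp y.ofLp := hK.le_mul_dist x y
    _ ≤ K * (2 / N) := mul_le_mul_of_nonneg_left hle K.2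
    _ < δ := by
        rw [div_lt_iff₀ hδ] at hN
        rw [← mul_div_assoc, div_lt_iff₀ hN0]
        linarith

end Grid

section Connectivity

variable {V : Type*} [Fintype V]

/-- A map from the sphere into a realization can be pushed, within carriers, to a map
extending over the ball as a map into a low-dimensional skeleton of the full simplex. -/
lemma exists_ball_map_posSupport_subset {F : Finset (Finset V)} (hF : IsComplexFamily F) {m : ℕ}
    [Nonempty V]
    (f : C(Metric.sphere (0 : EuclideanSpace ℝ (Fin m)) 1,
      ↥(realizationOf (F : Set (Finset V))))) :
    ∃ G : C(Metric.closedBall (0 : EuclideanSpace ℝ (Fin m)) 1, V → ℝ),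
      (∀ z v, 0 ≤ G z v) ∧ (∀ z, ∑ v, G z v = 1) ∧ (∀ z, (posSupport (G z)).card ≤ 2 ^ m) ∧
      ∀ y, posSupport (G ⟨y.1, Metric.sphere_subset_closedBall y.2⟩) ⊆ posSupport (f y).1 := by
  obtain ⟨δ, hδ, hball⟩ := lebesgue_number_lemma_of_metric
    (c := fun v : V => {y : Metric.sphere (0 : EuclideanSpace ℝ (Fin m)) 1 | 0 < (f y).1 v})
    isCompact_univ
    (fun v => isOpen_lt continuous_const
      ((continuous_apply v).comp (continuous_subtype_val.comp f.continuous)))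
    (fun y _ => by
      obtain ⟨-, hsum, -⟩ := (mem_realizationOf_iff hF).1 (f y).2
      obtain ⟨v, hv⟩ := posSupport_nonempty (hsum ▸ one_pos)
      exact Set.mem_iUnion.2 ⟨v, mem_posSupport.1 hv⟩)
  obtain ⟨N, hN⟩ := exists_grid_fine m hδ
  have hlabel : ∀ a : Fin m → ℤ, ∃ v : V,
      ∀ y : Metric.sphere (0 : EuclideanSpace ℝ (Fin m)) 1, 0 < hat N a y → 0 < (f y).1 v := by
    intro a
    by_cases ha : ∃ y : Metric.sphere (0 : EuclideanSpace ℝ (Fin m)) 1, 0 < hat N a y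
    · obtain ⟨y₀, hy₀⟩ := ha
      obtain ⟨v, hv⟩ := hball y₀ (Set.mem_univ _)
      exact ⟨v, fun y hy => hv (hN a y y₀ hy hy₀)⟩
    · exact ⟨Classical.arbitrary V, fun y hy => absurd ⟨y, hy⟩ ha⟩
  choose label hlabel using hlabel
  set raw : EuclideanSpace ℝ (Fin m) → V → ℝ := fun x v =>
    ∑ a ∈ gridBox m N with label a = v, hat N a x with hraw
  have hraw0 : ∀ x v, 0 ≤ raw x v := fun x v => Finset.sum_nonneg fun a _ => hat_nonneg N a x
  have hrawpos : ∀ x v, 0 < raw x v → ∃ a ∈ gridBox m N, 0 < hat N a x ∧ label a = v := by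
    intro x v hv
    obtain ⟨a, ha, hne⟩ := Finset.exists_ne_zero_of_sum_ne_zero hv.ne'
    rw [Finset.mem_filter] at ha
    exact ⟨a, ha.1, (hat_nonneg N a x).lt_of_ne' hne, ha.2⟩
  have hsum : ∀ z : Metric.closedBall (0 : EuclideanSpace ℝ (Fin m)) 1, 0 < ∑ v, raw z v := by
    intro z
    obtain ⟨a, ha, hpos⟩ := exists_hat_pos N (mem_closedBall_zero_iff.1 z.2)
    exact Finset.sum_pos' (fun v _ => hraw0 z v) ⟨label a, mem_univ _,
      Finset.sum_pos' (fun b _ => hat_nonneg N b z) ⟨a, by simp [ha], hpos⟩⟩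
  have hcont : Continuous fun z : Metric.closedBall (0 : EuclideanSpace ℝ (Fin m)) 1 =>
      normalized (raw z) := by
    refine continuous_normalized (continuous_pi fun v => ?_) hsum
    exact continuous_finsetSum _ fun a _ => (continuous_hat N a).comp continuous_subtype_val
  refine ⟨⟨_, hcont⟩, fun z => normalized_nonneg (hraw0 z), fun z => sum_normalized (hsum z),
    fun z => ?_, fun y => ?_⟩
  · change (posSupport (normalized (raw z))).card ≤ 2 ^ m
    rw [posSupport_normalized (hsum z)]
    have hsub : posSupport (raw z) ⊆
        ((gridBox m N).filter fun a => 0 < hat N a z.1).image label := fun v hv => by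
      obtain ⟨a, ha, hpos, hav⟩ := hrawpos z.1 v (mem_posSupport.1 hv)
      exact Finset.mem_image.2 ⟨a, Finset.mem_filter.2 ⟨ha, hpos⟩, hav⟩
    have hcard := card_hat_pos_le N z.1
    exact (Finset.card_le_card hsub).trans (Finset.card_image_le.trans hcard)
  · have hy : 0 < ∑ v, raw y.1 v := hsum ⟨y.1, Metric.sphere_subset_closedBall y.2⟩
    change posSupport (normalized (raw y.1)) ⊆ _
    rw [posSupport_normalized hy]
    intro v hv
    obtain ⟨a, -, hpos, rfl⟩ := hrawpos y.1 v (mem_posSupport.1 hv)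
    exact mem_posSupport.2 (hlabel a y hpos)

theorem nConnected_of_hasCones {F : Finset (Finset V)} (hF : IsComplexFamily F) (d : ℕ)
    (hcones : HasCones F (2 ^ (d + 1) + 2 ^ 2 ^ (d + 1))) :
    NConnected d ↥(realizationOf (F : Set (Finset V))) := by
  obtain ⟨v₀, hv₀⟩ := hcones ∅ (by simp)
  have : Nonempty V := ⟨v₀⟩
  refine ⟨⟨Pi.single v₀ 1, {v₀}, ?_, fun v => ?_, fun v hv => ?_, by simp⟩, fun k hk f => ?_⟩
  · simpa using hv₀ ∅ subset_rfl (Or.inl rfl)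
  · by_cases h : v = v₀
    · subst h
      simp
    · simp [h]
  · exact Pi.single_eq_of_ne (by simpa using hv) 1
  obtain ⟨G, hG0, hG1, hGM, hGf⟩ := exists_ball_map_posSupport_subset hF f
  let i : C(Metric.sphere (0 : EuclideanSpace ℝ (Fin (k + 1))) 1,
      Metric.closedBall (0 : EuclideanSpace ℝ (Fin (k + 1))) 1) :=
    ⟨fun y => ⟨y.1, Metric.sphere_subset_closedBall y.2⟩, continuous_subtype_val.subtype_mk _⟩
  have hmem : ∀ y, G (i y) ∈ realizationOf (F : Set (Finset V)) := fun y => by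
    refine (mem_realizationOf_iff hF).2 ⟨hG0 _, hG1 _, hF.2 _
      ((mem_realizationOf_iff hF).1 (f y).2).2.2 _ (hGf y) (posSupport_nonempty ?_)⟩
    rw [hG1]
    exact one_pos
  let g : C(Metric.sphere (0 : EuclideanSpace ℝ (Fin (k + 1))) 1,
      ↥(realizationOf (F : Set (Finset V)))) :=
    ⟨fun y => ⟨G (i y), hmem y⟩, (G.continuous.comp i.continuous).subtype_mk _⟩
  have hM : 2 ^ (k + 1) ≤ 2 ^ (d + 1) := Nat.pow_le_pow_right two_pos (by omega)
  have := Metric.contractibleSpace_closedBall (x := (0 : EuclideanSpace ℝ (Fin (k + 1)))) zero_le_one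
  obtain ⟨x, hx⟩ := nullhomotopic_of_extension hF
    (fun U hU => hcones U (hU.trans (Nat.add_le_add hM (Nat.pow_le_pow_right two_pos hM)))) i G hG0 hG1 hGM g
    fun y => rfl
  exact ⟨x, (homotopic_of_posSupport_subset hF f g hGf).trans hx⟩

end Connectivity

/-- Fix `d ≥ 0` and `0 < p < P < 1`.  In the medial regime
multiparameter random simplicial complex on `n` vertices, with all simplex
probabilities in `[p, P]`, the probability that the complex is `d`-connected tends to
`1` as `n → ∞`, uniformly over the choice of the probabilities. -/
theorem medial_regime_d_connected (d : ℕ) (p P : ℝ) (hp : 0 < p) (hpP : p < P)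
    (hP : P < 1) :
    ∀ ε : ℝ, 0 < ε → ∃ n₀ : ℕ, ∀ n : ℕ, n₀ ≤ n →
      ∀ pr : Finset (Fin n) → ℝ,
        (∀ σ : Finset (Fin n), σ.Nonempty → p ≤ pr σ ∧ pr σ ≤ P) →
        1 - ε ≤
          ∑ F ∈ Finset.univ.filter (fun F : Finset (Finset (Fin n)) =>
              IsComplexFamily F ∧
              NConnected d ↥(realizationOf (F : Set (Finset (Fin n))))),
            complexProb pr F := by
  intro ε hε
  set R := 2 ^ (d + 1) + 2 ^ 2 ^ (d + 1) with hR
  have hp1 : p < 1 := hpP.trans hP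
  have hq0 : 0 < 1 - p ^ 2 ^ R := sub_pos.2 (pow_lt_one₀ hp.le hp1 (by positivity))
  have hq1 : 1 - p ^ 2 ^ R < 1 := sub_lt_self _ (pow_pos hp _)
  obtain ⟨n₀, hn₀⟩ := Filter.eventually_atTop.1
    ((tendsto_pow_mul_pow_sub R hq0 hq1).eventually_lt_const hε)
  refine ⟨max n₀ R, fun n hn pr hpr => ?_⟩
  have hlow := one_sub_le_sum_trialWeight_hasCones hp hpP hP hpr (R := R)
    (by simpa using le_of_max_le_right hn)
  rw [Fintype.card_fin] at hlow
  rw [sum_complexProb_filter pr fun F => NConnected d ↥(realizationOf (F : Set (Finset (Fin n))))]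
  calc 1 - ε ≤ 1 - (n : ℝ) ^ R * (1 - p ^ 2 ^ R) ^ (n - R) := by
        linarith [hn₀ n (le_of_max_le_left hn)]
    _ ≤ _ := hlow
    _ ≤ _ := by
        refine Finset.sum_le_sum_of_subset_of_nonneg (fun A hA => ?_) fun A hA _ =>
          trialWeight_nonneg hp hP hpr (Finset.mem_filter.1 hA).1
        rw [Finset.mem_filter] at hA ⊢
        exact ⟨hA.1, nConnected_of_hasCones (isComplexFamily_complexOf A) d hA.2⟩
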